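/- Let E, F be finite-dimensional real inner product spaces, let A : E → F be a linear map, and let 0 < m ≤ M. Then there exists a constant γ ≥ 0, depending only on m, M, and A (in particular independent of the set C below), with the following property: for every (m,M)-strongly convex function h : E → ℝ, every closed convex set C ⊆ F, and all b₁, b₂ ∈ range(A) such that the sets U₁ = {x : Ax + b₁ ∈ C} and U₂ = {x : Ax + b₂ ∈ C} are nonempty, if x* ∈ U₁ satisfies h(x*) ≤ h(x) for all x ∈ U₁ and y* ∈ U₂ satisfies h(y*) ≤ h(y) for all y ∈ U₂, then ‖x* − y*‖ ≤ γ‖b₂ − b₁‖. -/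

import Mathlib

open scoped RealInnerProductSpace

/-- The range of a linear map of finite-dimensional spaces lifts back with a linear norm bound. -/
theorem LinearMap.exists_bounded_preimage {E F : Type*}
    [NormedAddCommGroup E] [InnerProductSpace ℝ E]
    [NormedAddCommGroup F] [InnerProductSpace ℝ F] [FiniteDimensional ℝ F]
    (A : E →ₗ[ℝ] F) :
    ∃ K : ℝ, 0 ≤ K ∧ ∀ b ∈ Set.range A, ∃ d : E, A d = b ∧ ‖d‖ ≤ K * ‖b‖ := by
  obtain ⟨B, hB⟩ := A.rangeRestrict.exists_rightInverse_of_surjective A.range_rangeRestrict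
  refine ⟨‖LinearMap.toContinuousLinearMap B‖, ContinuousLinearMap.opNorm_nonneg _, fun b hb => ?_⟩
  let bR : LinearMap.range A := ⟨b, hb⟩
  exact ⟨B bR, congrArg Subtype.val (LinearMap.congr_fun hB bR),
    (LinearMap.toContinuousLinearMap B).le_opNorm bR⟩

/-- The variational inequality at a minimizer of a differentiable function over a convex set. -/
theorem IsMinOn.inner_gradient_nonneg {E : Type*}
    [NormedAddCommGroup E] [InnerProductSpace ℝ E] [CompleteSpace E]
    {g : E → ℝ} {s : Set E} {x y : E} (h : IsMinOn g s x) (hg : DifferentiableAt ℝ g x)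
    (hs : Convex ℝ s) (hx : x ∈ s) (hy : y ∈ s) :
    0 ≤ ⟪gradient g x, y - x⟫ := by
  have := h.localize.hasFDerivWithinAt_nonneg
    hg.hasGradientAt.hasFDerivAt.hasFDerivWithinAt
    (sub_mem_posTangentConeAt_of_segment_subset (hs.segment_subset hx hy))
  simpa using this

/-- There is a constant `γ`, depending only on `m`, `M` and the linear map `A`, such that
for every `(m,M)`-strongly convex `g`, every closed convex set `C`, and all
`b₁, b₂ ∈ range A` with `U₁ = {x : Ax + b₁ ∈ C}` and `U₂ = {x : Ax + b₂ ∈ C}` nonempty,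
minimizers `x*` of `g` over `U₁` and `y*` of `g` over `U₂` satisfy
`‖x* − y*‖ ≤ γ ‖b₂ − b₁‖`. -/
theorem stmt_10 {E F : Type*}
    [NormedAddCommGroup E] [InnerProductSpace ℝ E] [FiniteDimensional ℝ E]
    [NormedAddCommGroup F] [InnerProductSpace ℝ F] [FiniteDimensional ℝ F]
    (A : E →ₗ[ℝ] F) (m M : ℝ) (hm : 0 < m) (hmM : m ≤ M) :
    ∃ γ : ℝ, 0 ≤ γ ∧
      ∀ g : E → ℝ, ConvexOn ℝ Set.univ g → Differentiable ℝ g →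
        (∀ x y : E, ‖gradient g x - gradient g y‖ ≤ M * ‖x - y‖) →
        (∀ x y : E, g x + ⟪gradient g x, y - x⟫ + (m / 2) * ‖y - x‖ ^ 2 ≤ g y) →
        ∀ C : Set F, IsClosed C → Convex ℝ C →
          ∀ b₁ b₂ : F, b₁ ∈ Set.range A → b₂ ∈ Set.range A →
            ∀ xs ys : E,
              xs ∈ {x : E | A x + b₁ ∈ C} → (∀ x ∈ {x : E | A x + b₁ ∈ C}, g xs ≤ g x) →
              ys ∈ {x : E | A x + b₂ ∈ C} → (∀ y ∈ {x : E | A x + b₂ ∈ C}, g ys ≤ g y) →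
              ‖xs - ys‖ ≤ γ * ‖b₂ - b₁‖ := by
  obtain ⟨K, hK, hA⟩ := A.exists_bounded_preimage
  have hM : 0 ≤ M := hm.le.trans hmM
  refine ⟨M / m * K, by positivity, ?_⟩
  intro g _ hg hL hS C _ hC b₁ b₂ hb₁ hb₂ xs ys hxs hx hys hy
  obtain ⟨d, hd, hdK⟩ := hA (b₂ - b₁) ((LinearMap.range A).sub_mem hb₂ hb₁)
  have hconv (b : F) : Convex ℝ {x : E | A x + b ∈ C} :=
    (hC.translate_preimage_left b).linear_preimage A
  have h₁ : 0 ≤ ⟪gradient g xs, ys + d - xs⟫ := by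
    refine IsMinOn.inner_gradient_nonneg (fun x h => hx x h) (hg xs) (hconv b₁) hxs ?_
    have : A (ys + d) + b₁ = A ys + b₂ := by rw [map_add, hd]; abel
    rw [Set.mem_ofPred_eq, this]
    exact hys
  have h₂ : 0 ≤ ⟪gradient g ys, xs - d - ys⟫ := by
    refine IsMinOn.inner_gradient_nonneg (fun y h => hy y h) (hg ys) (hconv b₂) hys ?_
    have : A (xs - d) + b₂ = A xs + b₁ := by rw [map_sub, hd]; abel
    rw [Set.mem_ofPred_eq, this]
    exact hxs
  have h₃ : m * ‖xs - ys‖ ^ 2 ≤ M * ‖xs - ys‖ * ‖d‖ := by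
    have hxy := hS xs ys
    have hyx := hS ys xs
    have hcs := (real_inner_le_norm (gradient g xs - gradient g ys) d).trans
      (mul_le_mul_of_nonneg_right (hL xs ys) (norm_nonneg d))
    rw [norm_sub_rev] at hxy
    simp only [inner_sub_left, inner_sub_right, inner_add_right] at *
    linarith
  have h₄ : m * ‖xs - ys‖ ≤ M * ‖d‖ := by
    rcases (norm_nonneg (xs - ys)).eq_or_lt with h | h
    · rw [← h, mul_zero]; positivity
    · exact le_of_mul_le_mul_right (by linarith) h
  calc ‖xs - ys‖ ≤ M * ‖d‖ / m := (le_div_iff₀' hm).2 h₄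
    _ ≤ M * (K * ‖b₂ - b₁‖) / m := by gcongr
    _ = M / m * K * ‖b₂ - b₁‖ := by ring
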